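/- For every n ≥ 2 and every odd positive integer ℓ, the image of B_n[2ℓ] under the mod 2 abelianization map of B_n[2] is all of H_1(B_n[2]; ℤ/2ℤ); equivalently, B_n[2] is generated by B_n[2ℓ] together with the subgroup of B_n[2] generated by all squares and commutators of elements of B_n[2]. -/

import Mathlib

open Matrix

/-- The braid relations on `m` generators `σ_1, …, σ_m` (0-indexed by `Fin m`). -/
def braidRels (m : ℕ) : Set (FreeGroup (Fin m)) :=
  {r | (∃ i j : Fin m, (i : ℕ) + 1 = (j : ℕ) ∧
          r = FreeGroup.of i * FreeGroup.of j * FreeGroup.of i *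
              (FreeGroup.of j * FreeGroup.of i * FreeGroup.of j)⁻¹) ∨
       (∃ i j : Fin m, (i : ℕ) + 2 ≤ (j : ℕ) ∧
          r = FreeGroup.of i * FreeGroup.of j * (FreeGroup.of j * FreeGroup.of i)⁻¹)}

/-- The braid group on `n` strands, presented on generators `σ_1, …, σ_{n-1}`. -/
def BraidGroup (n : ℕ) : Type := PresentedGroup (braidRels (n - 1))

instance (n : ℕ) : Group (BraidGroup n) :=
  inferInstanceAs (Group (PresentedGroup (braidRels (n - 1))))

/-- The generator `σ_{k+1}` (in 1-indexed notation) of the braid group. -/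
def braidGen (n : ℕ) (k : Fin (n - 1)) : BraidGroup n := PresentedGroup.of k

/-- The matrix of the generator `σ_{k+1}` under the reduced integral Burau representation. -/
def burauMatrix (n : ℕ) (k : Fin (n - 1)) : Matrix (Fin (n - 1)) (Fin (n - 1)) ℤ :=
  Matrix.of fun a b =>
    if a = b then 1
    else if (a : ℕ) + 1 = (k : ℕ) ∧ b = k then -1
    else if (a : ℕ) = (k : ℕ) + 1 ∧ b = k then 1
    else 0

/-- `ρ` is the reduced integral Burau representation iff it takes the prescribed
values on the generators. -/
def IsBurau (n : ℕ) (ρ : BraidGroup n →* GL (Fin (n - 1)) ℤ) : Prop :=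
  ∀ k : Fin (n - 1),
    (ρ (braidGen n k) : Matrix (Fin (n - 1)) (Fin (n - 1)) ℤ) = burauMatrix n k

/-- The level `ℓ` congruence subgroup `B_n[ℓ]`: the kernel of the composition of the
reduced integral Burau representation with entrywise reduction mod `ℓ`. -/
def congSubgroup (n : ℕ) (ρ : BraidGroup n →* GL (Fin (n - 1)) ℤ) (ℓ : ℕ) :
    Subgroup (BraidGroup n) :=
  ((Matrix.GeneralLinearGroup.map (Int.castRingHom (ZMod ℓ))).comp ρ).ker

instance (n : ℕ) (ρ : BraidGroup n →* GL (Fin (n - 1)) ℤ) (ℓ : ℕ) :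
    (congSubgroup n ρ ℓ).Normal :=
  MonoidHom.normal_ker _

instance (n : ℕ) (ρ : BraidGroup n →* GL (Fin (n - 1)) ℤ) (ℓ : ℕ)
    (K : Subgroup (BraidGroup n)) : ((congSubgroup n ρ ℓ).subgroupOf K).Normal :=
  Subgroup.Normal.subgroupOf (MonoidHom.normal_ker _) K

/-- The subgroup of `G` generated by all squares and all commutators; this is the
kernel of the mod 2 abelianization map `G → H₁(G; ℤ/2ℤ)`. -/
def sqCommSubgroup (G : Type*) [Group G] : Subgroup G :=
  Subgroup.closure
    ({x | ∃ y : G, x = y * y} ∪ {x | ∃ a b : G, x = a * b * a⁻¹ * b⁻¹})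

open Equiv

section CoxeterPresentation

variable {Q : Type*} [Group Q] {s : ℕ → Q} {M : ℕ}

/-- The descending product `s (m - 1) * s (m - 2) * ⋯ * s (m - d)`. -/
def descProd (s : ℕ → Q) (m : ℕ) : ℕ → Q
  | 0 => 1
  | d + 1 => descProd s m d * s (m - (d + 1))

/-- A generator below all the factors of a descending product commutes with it. -/
lemma descProd_mul_of_lt
    (hcomm : ∀ i j, i + 2 ≤ j → j < M → s i * s j = s j * s i)
    {m : ℕ} (hm : m ≤ M) {i d : ℕ} (h : i + 1 + d < m) :
    descProd s m d * s i = s i * descProd s m d := by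
  induction d with
  | zero => simp [descProd]
  | succ d ih =>
    rw [descProd, mul_assoc, ← hcomm i (m - (d + 1)) (by omega) (by omega), ← mul_assoc,
      ih (by omega), mul_assoc]

/-- Moving a generator leftwards through a descending product that contains it, other than as
the last factor, lowers its index by one. -/
lemma descProd_mul_of_gt
    (hbraid : ∀ i, i + 1 < M → s i * s (i + 1) * s i = s (i + 1) * s i * s (i + 1))
    (hcomm : ∀ i j, i + 2 ≤ j → j < M → s i * s j = s j * s i)
    {m : ℕ} (hm : m ≤ M) {i d : ℕ} (hd : d ≤ m) (hi : i + 1 < m) (h : m < i + 1 + d) :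
    descProd s m d * s (i + 1) = s i * descProd s m d := by
  induction d with
  | zero => omega
  | succ d ih =>
    rcases Nat.lt_or_ge m (i + 1 + d) with h' | h'
    · rw [descProd, mul_assoc, hcomm (m - (d + 1)) (i + 1) (by omega) (by omega), ← mul_assoc,
        ih (by omega) h', mul_assoc]
    · obtain ⟨e, rfl⟩ : ∃ e, d = e + 1 := ⟨d - 1, by omega⟩
      have h₁ : m - (e + 1 + 1) = i := by omega
      have h₂ : m - (e + 1) = i + 1 := by omega
      rw [descProd, descProd, h₁, h₂, mul_assoc, mul_assoc, ← mul_assoc (s (i + 1)),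
        ← hbraid i (by omega), ← mul_assoc, ← mul_assoc,
        descProd_mul_of_lt hcomm hm (by omega)]
      simp only [mul_assoc]

/-- Coset decomposition of the subgroup generated by the first `m + 1` Coxeter generators of
type `A` with respect to the one generated by the first `m`. -/
lemma exists_mul_descProd (hsq : ∀ i, i < M → s i * s i = 1)
    (hbraid : ∀ i, i + 1 < M → s i * s (i + 1) * s i = s (i + 1) * s i * s (i + 1))
    (hcomm : ∀ i j, i + 2 ≤ j → j < M → s i * s j = s j * s i)
    {m : ℕ} (hm : m + 1 ≤ M) {q : Q} (hq : q ∈ Subgroup.closure (s '' Set.Iio (m + 1))) :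
    ∃ h ∈ Subgroup.closure (s '' Set.Iio m), ∃ d ≤ m + 1, q = h * descProd s (m + 1) d := by
  have step : ∀ i < m + 1, ∀ q : Q,
      (∃ h ∈ Subgroup.closure (s '' Set.Iio m), ∃ d ≤ m + 1, q = h * descProd s (m + 1) d) →
      ∃ h ∈ Subgroup.closure (s '' Set.Iio m), ∃ d ≤ m + 1,
        q * s i = h * descProd s (m + 1) d := by
    rintro i hi _ ⟨h, hh, d, hd, rfl⟩
    have hmem : ∀ j < m, h * s j ∈ Subgroup.closure (s '' Set.Iio m) := fun j hj =>
      mul_mem hh (Subgroup.subset_closure ⟨j, hj, rfl⟩)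
    rcases lt_trichotomy (i + d) m with h' | h' | h'
    · exact ⟨h * s i, hmem i (by omega), d, hd, by
        rw [mul_assoc, descProd_mul_of_lt hcomm hm (by omega), mul_assoc]⟩
    · refine ⟨h, hh, d + 1, by omega, ?_⟩
      rw [descProd, show m + 1 - (d + 1) = i by omega, mul_assoc]
    · rcases Nat.lt_or_ge (m + 1) (i + d) with h'' | h''
      · obtain ⟨k, rfl⟩ : ∃ k, i = k + 1 := ⟨i - 1, by omega⟩
        exact ⟨h * s k, hmem k (by omega), d, hd, by
          rw [mul_assoc, descProd_mul_of_gt hbraid hcomm hm hd hi (by omega), mul_assoc]⟩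
      · obtain ⟨e, rfl⟩ : ∃ e, d = e + 1 := ⟨d - 1, by omega⟩
        refine ⟨h, hh, e, by omega, ?_⟩
        rw [descProd, show m + 1 - (e + 1) = i by omega, mul_assoc, mul_assoc,
          hsq i (by omega), mul_one]
  induction hq using Subgroup.closure_induction_right with
  | one => exact ⟨1, one_mem _, 0, by omega, by simp [descProd]⟩
  | mul_right x _ y hy ih =>
    obtain ⟨i, hi, rfl⟩ := hy
    exact step i hi x ih
  | mul_inv_cancel x _ y hy ih =>
    obtain ⟨i, hi, rfl⟩ := hy
    rw [inv_eq_of_mul_eq_one_right (hsq i (lt_of_lt_of_le hi hm))]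
    exact step i hi x ih

variable {φ : Q →* Perm ℕ}

/-- The first `m` adjacent transpositions fix every point beyond `m`. -/
lemma apply_eq_self_of_mem_closure (hφ : ∀ i, i < M → φ (s i) = swap i (i + 1))
    {m : ℕ} (hm : m ≤ M) {q : Q} (hq : q ∈ Subgroup.closure (s '' Set.Iio m))
    {x : ℕ} (hx : m < x) : φ q x = x := by
  have hle : Subgroup.closure (s '' Set.Iio m) ≤
      (MulAction.stabilizer (Perm ℕ) x).comap φ := by
    rw [Subgroup.closure_le]
    rintro _ ⟨i, hi, rfl⟩
    have hi' : i < m := hi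
    rw [SetLike.mem_coe, Subgroup.mem_comap, MulAction.mem_stabilizer_iff, Perm.smul_def,
      hφ i (by omega)]
    exact swap_apply_of_ne_of_ne (by omega) (by omega)
  exact hle hq

lemma apply_descProd (hφ : ∀ i, i < M → φ (s i) = swap i (i + 1))
    {m : ℕ} (hm : m ≤ M) {d : ℕ} (hd : d ≤ m) : φ (descProd s m d) (m - d) = m := by
  induction d with
  | zero => simp [descProd]
  | succ d ih =>
    rw [descProd, map_mul, Perm.mul_apply, hφ _ (by omega), swap_apply_left,
      show m - (d + 1) + 1 = m - d by omega]
    exact ih (by omega)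

/-- The Coxeter relations of type `A` present the symmetric group: an element of a group generated
by elements satisfying them is trivial as soon as the corresponding permutation is. -/
lemma eq_one_of_perm_eq_one (hsq : ∀ i, i < M → s i * s i = 1)
    (hbraid : ∀ i, i + 1 < M → s i * s (i + 1) * s i = s (i + 1) * s i * s (i + 1))
    (hcomm : ∀ i j, i + 2 ≤ j → j < M → s i * s j = s j * s i)
    (hφ : ∀ i, i < M → φ (s i) = swap i (i + 1))
    {m : ℕ} (hm : m ≤ M) {q : Q} (hq : q ∈ Subgroup.closure (s '' Set.Iio m))
    (h1 : φ q = 1) : q = 1 := by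
  induction m generalizing q with
  | zero => simpa using hq
  | succ m ih =>
    obtain ⟨h, hh, d, hd, rfl⟩ := exists_mul_descProd hsq hbraid hcomm hm hq
    have key : φ (h * descProd s (m + 1) d) (m + 1 - d) = m + 1 := by
      rw [map_mul, Perm.mul_apply, apply_descProd hφ hm hd]
      exact apply_eq_self_of_mem_closure hφ (by omega) hh (by omega)
    rw [h1, Perm.one_apply] at key
    obtain rfl : d = 0 := by omega
    rw [descProd, mul_one] at h1 ⊢
    exact ih (by omega) hh h1

end CoxeterPresentation

section Braid

lemma braidGen_braid {n : ℕ} {i j : Fin (n - 1)} (h : (i : ℕ) + 1 = j) :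
    braidGen n i * braidGen n j * braidGen n i = braidGen n j * braidGen n i * braidGen n j :=
  mul_inv_eq_one.mp (PresentedGroup.one_of_mem (rels := braidRels (n - 1))
    (Or.inl ⟨i, j, h, rfl⟩))

lemma braidGen_comm {n : ℕ} {i j : Fin (n - 1)} (h : (i : ℕ) + 2 ≤ j) :
    braidGen n i * braidGen n j = braidGen n j * braidGen n i :=
  mul_inv_eq_one.mp (PresentedGroup.one_of_mem (rels := braidRels (n - 1))
    (Or.inr ⟨i, j, h, rfl⟩))

lemma closure_range_braidGen (n : ℕ) : Subgroup.closure (Set.range (braidGen n)) = ⊤ :=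
  PresentedGroup.closure_range_of (braidRels (n - 1))

/-- The permutation of the strands induced by a braid, as a permutation of `ℕ`. -/
def braidPerm (n : ℕ) : BraidGroup n →* Perm ℕ :=
  PresentedGroup.toGroup (rels := braidRels (n - 1))
    (f := fun k : Fin (n - 1) => swap (k : ℕ) (k + 1)) (by
      rintro r (⟨i, j, hij, rfl⟩ | ⟨i, j, hij, rfl⟩)
      · simp only [map_mul, map_inv, FreeGroup.lift_apply_of, mul_inv_eq_one, ← hij]
        ext x
        simp only [Perm.mul_apply, swap_apply_def]
        split_ifs <;> omega
      · simp only [map_mul, map_inv, FreeGroup.lift_apply_of, mul_inv_eq_one]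
        ext x
        simp only [Perm.mul_apply, swap_apply_def]
        split_ifs <;> omega)

lemma braidPerm_braidGen (n : ℕ) (k : Fin (n - 1)) :
    braidPerm n (braidGen n k) = swap (k : ℕ) (k + 1) :=
  PresentedGroup.toGroup.of _

lemma braidPerm_apply_of_lt {n x : ℕ} (hx : n - 1 < x) (w : BraidGroup n) :
    braidPerm n w x = x := by
  have hle : Subgroup.closure (Set.range (braidGen n)) ≤
      (MulAction.stabilizer (Perm ℕ) x).comap (braidPerm n) := by
    rw [Subgroup.closure_le]
    rintro _ ⟨k, rfl⟩
    have := k.2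
    rw [SetLike.mem_coe, Subgroup.mem_comap, MulAction.mem_stabilizer_iff, Perm.smul_def,
      braidPerm_braidGen]
    exact swap_apply_of_ne_of_ne (by omega) (by omega)
  exact hle (closure_range_braidGen n ▸ Subgroup.mem_top w)

/-- A braid inducing the trivial permutation is a product of conjugates of squares of
generators. -/
lemma mem_normalClosure_of_braidPerm_eq_one {n : ℕ} {w : BraidGroup n}
    (hw : braidPerm n w = 1) :
    w ∈ Subgroup.normalClosure (Set.range fun k => braidGen n k ^ 2) := by
  set N := Subgroup.normalClosure (Set.range fun k => braidGen n k ^ 2) with hN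
  have hle : N ≤ (braidPerm n).ker := by
    refine Subgroup.normalClosure_le_normal ?_
    rintro _ ⟨k, rfl⟩
    simp [MonoidHom.mem_ker, braidPerm_braidGen, pow_two]
  let s : ℕ → BraidGroup n ⧸ N := fun i =>
    if h : i < n - 1 then QuotientGroup.mk' N (braidGen n ⟨i, h⟩) else 1
  have hs : ∀ i (h : i < n - 1), s i = QuotientGroup.mk' N (braidGen n ⟨i, h⟩) :=
    fun i h => dif_pos h
  have hgen : QuotientGroup.mk' N w ∈ Subgroup.closure (s '' Set.Iio (n - 1)) := by
    have hle' : Subgroup.closure (Set.range (braidGen n)) ≤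
        (Subgroup.closure (s '' Set.Iio (n - 1))).comap (QuotientGroup.mk' N) := by
      rw [Subgroup.closure_le]
      rintro _ ⟨k, rfl⟩
      exact Subgroup.subset_closure ⟨k, k.2, hs k k.2⟩
    exact hle' (closure_range_braidGen n ▸ Subgroup.mem_top w)
  refine (QuotientGroup.eq_one_iff w).mp
    (eq_one_of_perm_eq_one (φ := QuotientGroup.lift N (braidPerm n) hle)
      ?_ ?_ ?_ ?_ le_rfl hgen hw)
  · intro i hi
    rw [hs i hi, ← map_mul, ← pow_two]
    exact (QuotientGroup.eq_one_iff _).mpr (Subgroup.subset_normalClosure ⟨_, rfl⟩)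
  · intro i hi
    rw [hs i (by omega), hs (i + 1) hi]
    simp only [← map_mul]
    rw [braidGen_braid rfl]
  · intro i j hij hj
    rw [hs i (by omega), hs j hj, ← map_mul, ← map_mul, braidGen_comm hij]
  · intro i hi
    rw [hs i hi]
    exact braidPerm_braidGen n _

end Braid

section Burau

variable {n : ℕ} {ρ : BraidGroup n →* GL (Fin (n - 1)) ℤ}

lemma mem_congSubgroup_iff {ℓ : ℕ} {w : BraidGroup n} :
    w ∈ congSubgroup n ρ ℓ ↔
      (ρ w : Matrix (Fin (n - 1)) (Fin (n - 1)) ℤ).map (Int.castRingHom (ZMod ℓ)) = 1 := by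
  rw [congSubgroup, MonoidHom.mem_ker, Units.ext_iff]
  rfl

lemma congSubgroup_le_of_dvd {a b : ℕ} (h : a ∣ b) :
    congSubgroup n ρ b ≤ congSubgroup n ρ a := by
  intro w hw
  rw [mem_congSubgroup_iff] at hw ⊢
  have := congrArg (fun A => A.map (ZMod.castHom h (ZMod a))) hw
  simp only [Matrix.map_map] at this
  rw [Matrix.map_one _ (map_zero _) (map_one _)] at this
  rw [← this]
  ext i j
  simp

lemma burauMatrix_pow (k : Fin (n - 1)) (e : ℕ) :
    burauMatrix n k ^ e = 1 + (e : ℤ) • (burauMatrix n k - 1) := by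
  have hsq : (burauMatrix n k - 1) * (burauMatrix n k - 1) = 0 := by
    ext a b
    rw [Matrix.mul_apply, Matrix.zero_apply]
    refine Finset.sum_eq_zero fun c _ => ?_
    by_cases hc : c = k
    · subst hc
      have : (burauMatrix n c - 1) c b = 0 := by
        by_cases hb : c = b <;> simp [burauMatrix, hb]
      rw [this, mul_zero]
    · have : (burauMatrix n k - 1) a c = 0 := by
        by_cases ha : a = c <;> simp [burauMatrix, ha, hc]
      rw [this, zero_mul]
  induction e with
  | zero => simp
  | succ e ih =>
    have : burauMatrix n k = 1 + (burauMatrix n k - 1) := by abel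
    rw [pow_succ, ih]
    nth_rewrite 2 [this]
    rw [add_mul, mul_add, smul_mul_assoc, mul_add, hsq]
    push_cast
    simp only [mul_one, one_mul, add_zero, add_smul, one_smul]
    abel

lemma braidGen_pow_mem (hρ : IsBurau n ρ) (k : Fin (n - 1)) (e : ℕ) :
    braidGen n k ^ e ∈ congSubgroup n ρ e := by
  rw [mem_congSubgroup_iff, map_pow, Units.val_pow_eq_pow_val, hρ k, burauMatrix_pow]
  ext i j
  rw [Matrix.map_apply, Matrix.add_apply, Matrix.smul_apply, smul_eq_mul, map_add, map_mul,
    map_natCast, CharP.cast_eq_zero, zero_mul, add_zero, Matrix.one_apply, Matrix.one_apply,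
    apply_ite (Int.castRingHom (ZMod e)), map_one, map_zero]

/-- The mod 2 reduction of the vector `ε_k - ε_{k+1}`. -/
def adjDiff (k x : ℕ) : ZMod 2 := if x = k ∨ x = k + 1 then 1 else 0

lemma sum_burauMatrix_mul_adjDiff (k j : Fin (n - 1)) (x : ℕ) :
    ∑ c : Fin (n - 1), (burauMatrix n k j c : ZMod 2) * adjDiff c x =
      adjDiff j (swap (k : ℕ) (k + 1) x) := by
  have hrow : ∀ c : Fin (n - 1), (burauMatrix n k j c : ZMod 2) * adjDiff c x =
      (if j = c then adjDiff c x else 0) +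
        if k = c then
          (if (j : ℕ) + 1 = k ∨ (j : ℕ) = k + 1 then adjDiff c x else 0) else 0 := by
    intro c
    have hneg : (-1 : ZMod 2) = 1 := by decide
    simp only [burauMatrix, Matrix.of_apply, Fin.ext_iff]
    split_ifs <;> first | omega | simp [hneg]
  rw [Finset.sum_congr rfl fun c _ => hrow c, Finset.sum_add_distrib, Finset.sum_ite_eq,
    Finset.sum_ite_eq]
  simp only [Finset.mem_univ, if_true, adjDiff, swap_apply_def]
  split_ifs <;> first | omega | simp | decide

/-- The mod 2 Burau representation is the action on differences of adjacent basis vectors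
of the permutation representation. -/
lemma sum_burau_mul_adjDiff (hρ : IsBurau n ρ) (w : BraidGroup n) (j : Fin (n - 1)) (x : ℕ) :
    ∑ k : Fin (n - 1), (ρ w j k : ZMod 2) * adjDiff k x = adjDiff j (braidPerm n w x) := by
  have hw : w ∈ Subgroup.closure (Set.range (braidGen n)) :=
    closure_range_braidGen n ▸ Subgroup.mem_top w
  have hmul : ∀ u v : BraidGroup n, ∀ (j : Fin (n - 1)) (x : ℕ),
      ∑ k : Fin (n - 1), (ρ (u * v) j k : ZMod 2) * adjDiff k x =
        ∑ c : Fin (n - 1), (ρ u j c : ZMod 2) *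
          ∑ k : Fin (n - 1), (ρ v c k : ZMod 2) * adjDiff k x := by
    intro u v j x
    simp only [map_mul, Units.val_mul, Matrix.mul_apply, Int.cast_sum, Int.cast_mul,
      Finset.sum_mul, Finset.mul_sum, mul_assoc]
    exact Finset.sum_comm
  have hone : ∀ (j : Fin (n - 1)) (x : ℕ),
      ∑ k : Fin (n - 1), (ρ 1 j k : ZMod 2) * adjDiff k x = adjDiff j x := by
    intro j x
    simp [Matrix.one_apply]
  induction hw using Subgroup.closure_induction generalizing j x with
  | mem w hw =>
    obtain ⟨k, rfl⟩ := hw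
    rw [hρ k, braidPerm_braidGen]
    exact sum_burauMatrix_mul_adjDiff k j x
  | one => rw [hone, map_one, Perm.one_apply]
  | mul u v _ _ hu hv =>
    rw [hmul, map_mul, Perm.mul_apply, ← hu]
    exact Finset.sum_congr rfl fun c _ => by rw [hv]
  | inv u _ hu =>
    have h := hmul u⁻¹ u j ((braidPerm n u)⁻¹ x)
    simp only [hu, inv_mul_cancel, hone, ← Perm.mul_apply, mul_inv_cancel, Perm.one_apply] at h
    rw [← h, map_inv]

/-- Apart from the degenerate case `n = 2`, the level 2 subgroup consists of pure braids. -/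
lemma braidPerm_eq_one_of_mem (hn : 3 ≤ n) (hρ : IsBurau n ρ) {w : BraidGroup n}
    (hw : w ∈ congSubgroup n ρ 2) : braidPerm n w = 1 := by
  have hpres : ∀ j < n - 1, ∀ x, adjDiff j x = adjDiff j (braidPerm n w x) := by
    intro j hj x
    rw [mem_congSubgroup_iff] at hw
    rw [← sum_burau_mul_adjDiff hρ w ⟨j, hj⟩ x]
    have hentry : ∀ k : Fin (n - 1), (ρ w ⟨j, hj⟩ k : ZMod 2) = if ⟨j, hj⟩ = k then 1 else 0 :=
      fun k => congrFun (congrFun hw ⟨j, hj⟩) k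
    simp [hentry]
  have hmem : ∀ j < n - 1, ∀ x,
      (x = j ∨ x = j + 1) ↔ (braidPerm n w x = j ∨ braidPerm n w x = j + 1) := by
    intro j hj x
    have := hpres j hj x
    unfold adjDiff at this
    split_ifs at this <;> simp_all
  have hmid : ∀ x, 1 ≤ x → x < n - 1 → braidPerm n w x = x := by
    intro x h₁ h₂
    have := hmem x h₂ x
    have := hmem (x - 1) (by omega) x
    omega
  have hinj := (braidPerm n w).injective
  have hlarge : ∀ x, n - 1 < x → braidPerm n w x = x := fun x hx =>
    braidPerm_apply_of_lt hx w
  ext x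
  rw [Perm.one_apply]
  rcases Nat.lt_or_ge (n - 1) x with h | h
  · exact hlarge x h
  · rcases Nat.eq_zero_or_pos x with rfl | h₀
    · have := hmem 0 (by omega) 0
      have h₁ := hmid 1 le_rfl (by omega)
      have := hinj.ne (show (0 : ℕ) ≠ 1 by omega)
      omega
    · rcases h.lt_or_eq with h' | rfl
      · exact hmid x h₀ h'
      · have := hmem (n - 2) (by omega) (n - 1)
        have h₁ := hmid (n - 2) (by omega) (by omega)
        have := hinj.ne (show n - 1 ≠ n - 2 by omega)
        omega

lemma congSubgroup_eq_top_of_eq_two (hn : n = 2) (hρ : IsBurau n ρ) (ℓ : ℕ) :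
    congSubgroup n ρ ℓ = ⊤ := by
  subst hn
  rw [eq_top_iff, ← closure_range_braidGen, Subgroup.closure_le]
  rintro _ ⟨k, rfl⟩
  rw [SetLike.mem_coe, mem_congSubgroup_iff, hρ k]
  ext i j
  obtain rfl : i = j := Subsingleton.elim (α := Fin 1) i j
  simp [burauMatrix]

/-- An element whose odd power lies in `H` lies in the subgroup generated by `H` and the
squares of elements of any subgroup `K` containing it. -/
lemma mem_sup_sqComm_of_pow_mem {G : Type*} [Group G] {H K : Subgroup G} {e : ℕ} (he : Odd e)
    {a : G} (haK : a ∈ K) (ha : a ^ e ∈ H) :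
    a ∈ H ⊔ Subgroup.map K.subtype (sqCommSubgroup K) := by
  obtain ⟨r, rfl⟩ := he
  have hsq : (a ^ r)⁻¹ * (a ^ r)⁻¹ ∈ Subgroup.map K.subtype (sqCommSubgroup K) :=
    ⟨(⟨a, haK⟩ ^ r)⁻¹ * (⟨a, haK⟩ ^ r)⁻¹, Subgroup.subset_closure (Or.inl ⟨_, rfl⟩), rfl⟩
  have : a = a ^ (2 * r + 1) * ((a ^ r)⁻¹ * (a ^ r)⁻¹) := by group
  rw [this]
  exact Subgroup.mul_mem_sup ha hsq

end Burau

/-- For every `n ≥ 2` and every odd positive integer `ℓ`, the image of `B_n[2ℓ]`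
under the mod 2 abelianization map of `B_n[2]` is all of `H₁(B_n[2]; ℤ/2ℤ)`;
equivalently, `B_n[2]` is generated by `B_n[2ℓ]` together with the subgroup of
`B_n[2]` generated by all squares and commutators of elements of `B_n[2]`. -/
theorem congSubgroup_sup_sqComm (n : ℕ) (hn : 2 ≤ n) (ℓ : ℕ) (hℓ : 0 < ℓ)
    (hodd : Odd ℓ)
    (ρ : BraidGroup n →* GL (Fin (n - 1)) ℤ) (hρ : IsBurau n ρ) :
    congSubgroup n ρ (2 * ℓ) ⊔
        Subgroup.map (congSubgroup n ρ 2).subtype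
          (sqCommSubgroup ↥(congSubgroup n ρ 2)) =
      congSubgroup n ρ 2 := by
  refine le_antisymm (sup_le (congSubgroup_le_of_dvd (dvd_mul_right 2 ℓ))
    (Subgroup.map_subtype_le _)) ?_
  rcases hn.eq_or_lt with h2 | h3
  · rw [congSubgroup_eq_top_of_eq_two h2.symm hρ (2 * ℓ), top_sup_eq]
    exact le_top
  · intro w hw
    have hle : Subgroup.normalClosure (Set.range fun k => braidGen n k ^ 2) ≤
        congSubgroup n ρ (2 * ℓ) ⊔
          Subgroup.map (congSubgroup n ρ 2).subtype (sqCommSubgroup ↥(congSubgroup n ρ 2)) := by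
      rw [Subgroup.normalClosure, Subgroup.closure_le]
      intro a ha
      obtain ⟨_, ⟨k, rfl⟩, hconj⟩ := Group.mem_conjugatesOfSet_iff.mp ha
      obtain ⟨g, rfl⟩ := isConj_iff.mp hconj
      refine mem_sup_sqComm_of_pow_mem hodd ?_ ?_
      · exact (inferInstance : (congSubgroup n ρ 2).Normal).conj_mem _ (braidGen_pow_mem hρ k 2) g
      · rw [conj_pow, ← pow_mul]
        exact (inferInstance : (congSubgroup n ρ (2 * ℓ)).Normal).conj_mem _
          (braidGen_pow_mem hρ k (2 * ℓ)) g
    exact hle (mem_normalClosure_of_braidPerm_eq_one (braidPerm_eq_one_of_mem h3 hρ hw))
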